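/- arXiv:2411.01638 — 3 statements merged into one kernel-verified Lean document; each statement's English description precedes it below -/
import Mathlib

section
/- Let p = 3k + 1 be a prime and let r be an integer whose residue modulo p is not a cube in the field with p elements. Then X_{p²+p}(r) ≡ 1 (mod p), Y_{p²+p}(r) ≡ r^k + r^{2k} (mod p), and Z_{p²+p}(r) ≡ 1 (mod p). -/
/-- The Pell-X sequence of parameter `r`. -/
def pellX (r : ℤ) : ℕ → ℤ
  | 0 => 1
  | 1 => 1
  | 2 => 1
  | n + 3 => 3 * pellX r (n + 2) - 3 * pellX r (n + 1) + (r + 1) * pellX r n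

/-- The Pell-Y sequence of parameter `r`. -/
def pellY (r : ℤ) : ℕ → ℤ
  | 0 => 0
  | 1 => 1
  | 2 => 2
  | n + 3 => 3 * pellY r (n + 2) - 3 * pellY r (n + 1) + (r + 1) * pellY r n

/-- The Pell-Z sequence of parameter `r`. -/
def pellZ (r : ℤ) : ℕ → ℤ
  | 0 => 0
  | 1 => 0
  | 2 => 1
  | n + 3 => 3 * pellZ r (n + 2) - 3 * pellZ r (n + 1) + (r + 1) * pellZ r n

theorem one_add_pow_eq_pell {R : Type*} [CommRing R] (r : ℤ) (t : R) (ht : t ^ 3 = r) (n : ℕ) :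
    (1 + t) ^ n = pellX r n + pellY r n * t + pellZ r n * t ^ 2 := by
  induction n using Nat.strong_induction_on with
  | _ n ih =>
    match n with
    | 0 => simp [pellX, pellY, pellZ]
    | 1 => simp [pellX, pellY, pellZ]
    | 2 => simp [pellX, pellY, pellZ]; ring
    | n + 3 =>
      have h0 := ih n (by omega)
      have h1 := ih (n + 1) (by omega)
      have h2 := ih (n + 2) (by omega)
      simp only [pellX, pellY, pellZ]
      push_cast
      linear_combination (1 + t) ^ n * ht + 3 * h2 - 3 * h1 + (r + 1) * h0

open Polynomial in
theorem coeffs_eq_of_root_combination_eq {K : Type*} [Field K] {c a₀ a₁ a₂ b₀ b₁ b₂ : K}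
    (h : AdjoinRoot.mk (X ^ 3 - C c) (C a₀ + C a₁ * X + C a₂ * X ^ 2) =
      AdjoinRoot.mk (X ^ 3 - C c) (C b₀ + C b₁ * X + C b₂ * X ^ 2)) :
    a₀ = b₀ ∧ a₁ = b₁ ∧ a₂ = b₂ := by
  have hdvd := AdjoinRoot.mk_eq_mk.mp h
  have hzero := eq_zero_of_dvd_of_degree_lt hdvd <| by
    rw [degree_X_pow_sub_C (by norm_num)]
    refine lt_of_le_of_lt (b := 2) ?_ (by norm_num)
    compute_degree
  have hcoeff (i : ℕ) := congrArg (coeff · i) hzero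
  have h0 := hcoeff 0
  have h1 := hcoeff 1
  have h2 := hcoeff 2
  simp [coeff_X, coeff_C, coeff_X_pow, sub_eq_zero] at h0 h1 h2
  exact ⟨h0, h1, h2⟩

open Polynomial in
theorem stmt_10 (p k : ℕ) (hp : p.Prime) (hpk : p = 3 * k + 1) (r : ℤ)
    (hr : ∀ b : ZMod p, b ^ 3 ≠ (r : ZMod p)) :
    pellX r (p ^ 2 + p) ≡ 1 [ZMOD (p : ℤ)] ∧
      pellY r (p ^ 2 + p) ≡ r ^ k + r ^ (2 * k) [ZMOD (p : ℤ)] ∧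
      pellZ r (p ^ 2 + p) ≡ 1 [ZMOD (p : ℤ)] := by
  have : Fact p.Prime := ⟨hp⟩
  have hr0 : (r : ZMod p) ≠ 0 := fun h => hr 0 (by simp [h])
  set c : ZMod p := (r : ZMod p)
  have hck : c ^ (3 * k) = 1 := by
    have h := ZMod.pow_card_sub_one_eq_one hr0
    rwa [show p - 1 = 3 * k by omega] at h
  set φ := AdjoinRoot.mk (X ^ 3 - C c)
  have ht : φ X ^ 3 = φ (C c) := by
    rw [← map_pow]
    exact AdjoinRoot.mk_eq_mk.mpr dvd_rfl
  have htr : φ X ^ 3 = (r : AdjoinRoot (X ^ 3 - C c)) :=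
    ht.trans (map_intCast (φ.comp C) r)
  have htp : φ X ^ p = φ (C (c ^ k)) * φ X := by
    have h := congrArg (φ X ^ ·) hpk
    rwa [pow_succ _ (3 * k), pow_mul _ 3 k, ht, ← map_pow φ (C c), ← C_pow] at h
  have htp2 : φ X ^ p ^ 2 = φ (C (c ^ (2 * k))) * φ X := by
    rw [sq, pow_mul, htp, mul_pow, htp, ← map_pow, ← C_pow, ZMod.pow_card, ← mul_assoc,
      ← map_mul, ← C_mul, ← pow_add, two_mul]
  have hfrob : (1 + φ X) ^ p = 1 + φ X ^ p := by
    have h := congrArg φ (add_pow_char (1 : (ZMod p)[X]) X p)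
    simpa using h
  have hfrob2 : (1 + φ X) ^ p ^ 2 = 1 + φ X ^ p ^ 2 := by
    have h := congrArg φ (add_pow_char_pow (1 : (ZMod p)[X]) X (p := p) (n := 2))
    simpa using h
  have hpow := one_add_pow_eq_pell r (φ X) htr (p ^ 2 + p)
  rw [pow_add, hfrob, hfrob2, htp, htp2] at hpow
  have hck' : φ (C (c ^ (2 * k))) * φ (C (c ^ k)) = 1 := by
    rw [← map_mul, ← C_mul, ← pow_add, show 2 * k + k = 3 * k by ring, hck]
    simp
  have key : φ (C (pellX r (p ^ 2 + p) : ZMod p) + C (pellY r (p ^ 2 + p) : ZMod p) * X +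
      C (pellZ r (p ^ 2 + p) : ZMod p) * X ^ 2) =
      φ (C 1 + C (c ^ k + c ^ (2 * k)) * X + C 1 * X ^ 2) := by
    have hint (z : ℤ) : φ (C (z : ZMod p)) = z := by simp
    have hadd : φ (C (c ^ k + c ^ (2 * k))) = φ (C (c ^ k)) + φ (C (c ^ (2 * k))) := by
      rw [C_add, map_add]
    simp only [hadd, map_add φ, map_mul φ, map_pow φ, hint, map_one]
    linear_combination -hpow + φ X ^ 2 * hck'
  obtain ⟨hX, hY, hZ⟩ := coeffs_eq_of_root_combination_eq key
  simp only [← ZMod.intCast_eq_intCast_iff]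
  push_cast
  exact ⟨hX, hY, hZ⟩
end

section
/- Let p > 3 be a prime congruent to 2 modulo 3 and let r be any integer. Then the rank of appearance of p in the Pell-Y sequence of parameter r is at most p; that is, there exists a positive integer m with m ≤ p such that p divides Y_m(r). -/
/-- The companion matrix of `X ^ 3 - r`. -/
def cubeRootMatrix {R : Type*} [CommRing R] (r : R) : Matrix (Fin 3) (Fin 3) R :=
  !![0, 0, r; 1, 0, 0; 0, 1, 0]

theorem cubeRootMatrix_sq {R : Type*} [CommRing R] (r : R) :
    cubeRootMatrix r ^ 2 = !![0, r, 0; 0, 0, r; 1, 0, 0] := by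
  ext i j
  fin_cases i <;> fin_cases j <;>
    simp [cubeRootMatrix, pow_two, Matrix.mul_apply, Fin.sum_univ_three]

theorem cubeRootMatrix_cube {R : Type*} [CommRing R] (r : R) :
    cubeRootMatrix r ^ 3 = r • (1 : Matrix (Fin 3) (Fin 3) R) := by
  rw [pow_succ, cubeRootMatrix_sq]
  ext i j
  fin_cases i <;> fin_cases j <;>
    simp [cubeRootMatrix, Matrix.mul_apply, Fin.sum_univ_three]

theorem cubeRootMatrix_pow_three_mul_add_two {R : Type*} [CommRing R] (r : R) (k : ℕ) :
    cubeRootMatrix r ^ (3 * k + 2) = r ^ k • cubeRootMatrix r ^ 2 := by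
  rw [pow_add, pow_mul, cubeRootMatrix_cube, smul_pow, one_pow, smul_mul_assoc, one_mul]

theorem cubeRootMatrix_add_one_cube {R : Type*} [CommRing R] (r : R) :
    (cubeRootMatrix r + 1) ^ 3 =
      (3 : R) • (cubeRootMatrix r + 1) ^ 2 - (3 : R) • (cubeRootMatrix r + 1) +
        (r + 1) • (1 : Matrix (Fin 3) (Fin 3) R) := by
  have expand : (cubeRootMatrix r + 1) ^ 3 = cubeRootMatrix r ^ 3 +
      (3 : R) • (cubeRootMatrix r + 1) ^ 2 - (3 : R) • (cubeRootMatrix r + 1) + 1 := by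
    simp only [ofNat_smul_eq_nsmul]
    noncomm_ring
  rw [expand, cubeRootMatrix_cube, add_smul, one_smul]
  abel

/-- `pellY r n` is the coefficient of `α` in `(α + 1) ^ n`, where `α ^ 3 = r`. -/
theorem cast_pellY_eq_pow_apply {R : Type*} [CommRing R] (r : ℤ) (n : ℕ) :
    (pellY r n : R) = ((cubeRootMatrix (r : R) + 1) ^ n) 1 0 := by
  induction n using pellY.induct with
  | case1 => simp [pellY]
  | case2 => simp [pellY, cubeRootMatrix]
  | case3 =>
    simp [pellY, cubeRootMatrix, pow_two, Matrix.mul_apply, Fin.sum_univ_three]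
    norm_num
  | case4 n ih₂ ih₁ ih₀ =>
    change _ = ((cubeRootMatrix (r : R) + 1) ^ (n + 3)) 1 0
    rw [pellY, pow_add, cubeRootMatrix_add_one_cube, mul_add, mul_sub, mul_smul_comm,
      mul_smul_comm, mul_smul_comm, mul_one, ← pow_add, ← pow_succ]
    simp [ih₂, ih₁, ih₀]

theorem dvd_pellY_self (p : ℕ) (hp : p.Prime) (hpmod : p % 3 = 2) (r : ℤ) :
    (p : ℤ) ∣ pellY r p := by
  have : Fact p.Prime := ⟨hp⟩
  obtain ⟨k, hk⟩ : ∃ k, p = 3 * k + 2 := ⟨p / 3, by omega⟩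
  have hpow : cubeRootMatrix (r : ZMod p) ^ p =
      (r : ZMod p) ^ k • cubeRootMatrix (r : ZMod p) ^ 2 :=
    (congrArg (cubeRootMatrix (r : ZMod p) ^ ·) hk).trans (cubeRootMatrix_pow_three_mul_add_two _ k)
  rw [← ZMod.intCast_zmod_eq_zero_iff_dvd, cast_pellY_eq_pow_apply,
    add_pow_char_of_commute p (Commute.one_right _), one_pow, hpow, cubeRootMatrix_sq]
  simp

theorem stmt_13 (p : ℕ) (hp : p.Prime) (hp3 : 3 < p) (hpmod : p % 3 = 2) (r : ℤ) :
    ∃ m : ℕ, 0 < m ∧ m ≤ p ∧ (p : ℤ) ∣ pellY r m :=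
  ⟨p, hp.pos, le_rfl, dvd_pellY_self p hp hpmod r⟩
end

section
/- Let p = 3k + 1 be a prime and let r be a positive integer whose residue modulo p is not a cube in the field with p elements. Then the p-th power (x_p, y_p, z_p) of (1, 1, 0) under ×_r satisfies the four necessary primality conditions: x_p ≡ 1 (mod p), y_p ≡ r^k (mod p), z_p ≡ 0 (mod p), and y_p + y_p² ≡ −1 (mod p). -/
/-- The product `×_r` on `ℤ³`. -/
def pellMul (r : ℤ) (a b : ℤ × ℤ × ℤ) : ℤ × ℤ × ℤ :=
  (a.1 * b.1 + r * (a.2.1 * b.2.2 + a.2.2 * b.2.1),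
   a.1 * b.2.1 + a.2.1 * b.1 + r * a.2.2 * b.2.2,
   a.1 * b.2.2 + a.2.1 * b.2.1 + a.2.2 * b.1)

/-- The `k`-th power of `(1, 1, 0)` under `×_r`. -/
def pellPow (r : ℤ) : ℕ → ℤ × ℤ × ℤ
  | 0 => (1, 0, 0)
  | k + 1 => pellMul r (1, 1, 0) (pellPow r k)

theorem cubeRootMatrix_pow_three {R : Type*} [CommRing R] (r : R) :
    cubeRootMatrix r ^ 3 = r • 1 := by
  ext i j
  fin_cases i <;> fin_cases j <;>
    simp [cubeRootMatrix, pow_succ, Matrix.mul_apply, Fin.sum_univ_three]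

theorem one_add_cubeRootMatrix_pow_mulVec {R : Type*} [CommRing R] (r : ℤ) (n : ℕ) :
    Matrix.mulVec ((1 + cubeRootMatrix (r : R)) ^ n) ![1, 0, 0] =
      ![((pellPow r n).1 : R), ((pellPow r n).2.1 : R), ((pellPow r n).2.2 : R)] := by
  induction n with
  | zero => simp [pellPow]
  | succ n ih =>
    rw [pow_succ', ← Matrix.mulVec_mulVec, ih, Matrix.add_mulVec, Matrix.one_mulVec]
    ext i
    fin_cases i <;>
      simp [cubeRootMatrix, pellPow, pellMul] <;> ring

theorem pellPow_prime_cast {p k : ℕ} [Fact p.Prime] (hpk : p = 3 * k + 1) (r : ℤ) :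
    ((pellPow r p).1 : ZMod p) = 1 ∧ ((pellPow r p).2.1 : ZMod p) = (r : ZMod p) ^ k ∧
      ((pellPow r p).2.2 : ZMod p) = 0 := by
  have hpow : cubeRootMatrix (r : ZMod p) ^ p =
      (r : ZMod p) ^ k • cubeRootMatrix (r : ZMod p) := by
    rw [congrArg (cubeRootMatrix (r : ZMod p) ^ ·) hpk, pow_succ, pow_mul,
      cubeRootMatrix_pow_three, smul_pow, one_pow, smul_mul_assoc, one_mul]
  have h := one_add_cubeRootMatrix_pow_mulVec (R := ZMod p) r p
  rw [add_pow_char_of_commute p (Commute.one_left _), one_pow, hpow] at h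
  have h0 := congrFun h 0
  have h1 := congrFun h 1
  have h2 := congrFun h 2
  simp [cubeRootMatrix, Matrix.mulVec, dotProduct, Fin.sum_univ_three] at h0 h1 h2
  exact ⟨h0.symm, h1.symm, h2.symm⟩

theorem exists_pow_three_eq_of_pow_eq_one {F : Type*} [Field F] [Finite F] {k : ℕ}
    (hk : Nat.card F = 3 * k + 1) {a : F} (ha : a ≠ 0) (h : a ^ k = 1) : ∃ b : F, b ^ 3 = a := by
  obtain ⟨g, hg⟩ := IsCyclic.exists_generator (α := Fˣ)
  have hord : orderOf g = 3 * k := by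
    rw [orderOf_eq_card_of_forall_mem_zpowers hg, Nat.card_units, hk, Nat.add_sub_cancel]
  have hkpos : 0 < k := by
    have := orderOf_pos g
    omega
  obtain ⟨m, hm⟩ := (Submonoid.mem_powers_iff _ _).mp
    (mem_powers_iff_mem_zpowers.mpr (hg (Units.mk0 a ha)))
  have hgm : g ^ (m * k) = 1 := by
    rw [pow_mul, hm]
    ext
    simpa using h
  obtain ⟨c, rfl⟩ : 3 ∣ m :=
    Nat.dvd_of_mul_dvd_mul_right hkpos (hord ▸ orderOf_dvd_of_pow_eq_one hgm)
  refine ⟨(g ^ c : Fˣ), ?_⟩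
  rw [← Units.val_pow_eq_pow_val, ← pow_mul, mul_comm, hm, Units.val_mk0]

theorem stmt_18 (p k : ℕ) (hp : p.Prime) (hpk : p = 3 * k + 1) (r : ℤ) (hr : 0 < r)
    (hnc : ∀ b : ZMod p, b ^ 3 ≠ (r : ZMod p)) :
    (pellPow r p).1 ≡ 1 [ZMOD (p : ℤ)] ∧
    (pellPow r p).2.1 ≡ r ^ k [ZMOD (p : ℤ)] ∧
    (pellPow r p).2.2 ≡ 0 [ZMOD (p : ℤ)] ∧
    (pellPow r p).2.1 + (pellPow r p).2.1 ^ 2 ≡ -1 [ZMOD (p : ℤ)] := by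
  have : Fact p.Prime := ⟨hp⟩
  obtain ⟨hx, hy, hz⟩ := pellPow_prime_cast hpk r
  have hr0 : (r : ZMod p) ≠ 0 := fun h => hnc 0 (by simp [h])
  have hw3 : ((r : ZMod p) ^ k) ^ 3 = 1 := by
    rw [← pow_mul, mul_comm, show 3 * k = p - 1 by omega]
    exact ZMod.pow_card_sub_one_eq_one hr0
  have hw1 : (r : ZMod p) ^ k ≠ 1 := fun h => by
    obtain ⟨b, hb⟩ := exists_pow_three_eq_of_pow_eq_one (by rwa [Nat.card_zmod]) hr0 h
    exact hnc b hb
  have hroot : (r : ZMod p) ^ k + ((r : ZMod p) ^ k) ^ 2 = -1 :=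
    mul_left_cancel₀ (sub_ne_zero.mpr hw1) (by linear_combination hw3)
  simp only [← ZMod.intCast_eq_intCast_iff]
  push_cast
  exact ⟨hx, hy, hz, by rw [hy, hroot]⟩
end
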